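/- Let R be a principal ideal domain with field of fractions F, let 0 < r < n, f = n − r, let p ∈ R be prime, K ∈ M_{r,f}(R), and J = (p·I_r | K), with N the nullspace of J in R^n and W the R-span of V(1), …, V(f). Let K̄ be the reduction of K modulo Rp over the field R̄ = R/Rp. Then, as R̄-vector spaces, dim(W/N) = rank(K̄) and dim(N/pW) = f − rank(K̄). -/

import Mathlib

open scoped Pointwise

/-- The matrix `J = (d·I_r | K) ∈ M_{r,n}(R)`: its first `r` columns form `d·I_r`
and its last `n - r` columns form `K`. -/
noncomputable def Jmat (R : Type*) [CommRing R] (r n : ℕ) (d : R)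
    (K : Matrix (Fin r) (Fin (n - r)) R) : Matrix (Fin r) (Fin n) R := fun i j =>
  if hj : (j : ℕ) < r then (if (i : ℕ) = (j : ℕ) then d else 0)
  else K i ⟨(j : ℕ) - r, by have := j.isLt; omega⟩

/-- The vector `V(j) ∈ F^n` whose `i`-th coordinate is `-K_{i,j}/d` for `i < r`,
which is `1` in position `r + j`, and `0` elsewhere. -/
noncomputable def Vvec (R : Type*) [CommRing R] [IsDomain R] (r n : ℕ) (d : R)
    (K : Matrix (Fin r) (Fin (n - r)) R) (j : Fin (n - r)) :
    Fin n → FractionRing R := fun i =>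
  if hi : (i : ℕ) < r then
    -(algebraMap R (FractionRing R) (K ⟨(i : ℕ), hi⟩ j)) / algebraMap R (FractionRing R) d
  else if (i : ℕ) = r + (j : ℕ) then 1 else 0

/-- The coordinatewise inclusion `R^n → F^n`, as an `R`-linear map. -/
noncomputable def toFrac (R : Type*) [CommRing R] (n : ℕ) :
    (Fin n → R) →ₗ[R] (Fin n → FractionRing R) :=
  LinearMap.pi fun i => (Algebra.linearMap R (FractionRing R)).comp (LinearMap.proj i)

/-- The nullspace `N = {X ∈ R^n : JX = 0}` of `J` in `R^n`, viewed (via the inclusion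
`R^n ⊆ F^n`) as an `R`-submodule of `F^n`. -/
noncomputable def Nsub (R : Type*) [CommRing R] [IsDomain R] (r n : ℕ) (d : R)
    (K : Matrix (Fin r) (Fin (n - r)) R) : Submodule R (Fin n → FractionRing R) :=
  (LinearMap.ker (Jmat R r n d K).mulVecLin).map (toFrac R n)

/-- `W`, the `R`-span of `V(1), …, V(f)` in `F^n`. -/
noncomputable def Wsub (R : Type*) [CommRing R] [IsDomain R] (r n : ℕ) (d : R)
    (K : Matrix (Fin r) (Fin (n - r)) R) : Submodule R (Fin n → FractionRing R) :=
  Submodule.span R (Set.range (Vvec R r n d K))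

section FreeParametrization

variable {R : Type*} [CommRing R]

/-- A quotient of an `R`-module that embeds, with image a subspace of dimension `m`, into a
vector space over a residue field `k` of `R` is isomorphic to `k ^ m`. -/
theorem nonempty_quotient_equiv_of_range {k M V : Type*} [Field k] [Algebra R k]
    [AddCommGroup M] [Module R M] [AddCommGroup V] [Module k V] [Module R V]
    [IsScalarTower R k V] [FiniteDimensional k V] (g : M →ₗ[R] V) (P : Submodule R M)
    (hP : LinearMap.ker g = P) (S : Submodule k V)
    (hS : LinearMap.range g = S.restrictScalars R) {m : ℕ} (hm : Module.finrank k S = m) :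
    Nonempty ((M ⧸ P) ≃ₗ[R] (Fin m → k)) := by
  subst hP
  have e : S ≃ₗ[k] (Fin m → k) := LinearEquiv.ofFinrankEq _ _ (by simp [hm])
  exact ⟨g.quotKerEquivRange.trans ((LinearEquiv.ofEq _ _ hS).trans (e.restrictScalars R))⟩

theorem Jmat_mulVec_apply {r n : ℕ} (hrn : r < n) (d : R)
    (K : Matrix (Fin r) (Fin (n - r)) R) (x : Fin n → R) (i : Fin r) :
    (Jmat R r n d K).mulVec x i = d * x ⟨i, i.isLt.trans hrn⟩ +
      K.mulVec (fun j => x ⟨r + j, by omega⟩) i := by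
  let e : Fin r ⊕ Fin (n - r) ≃ Fin n := finSumFinEquiv.trans (finCongr (by omega))
  simp only [Matrix.mulVec, dotProduct]
  rw [← e.sum_comp, Fintype.sum_sum_type]
  congr 1
  · rw [Finset.sum_eq_single i]
    · simp [e, Jmat]
      rfl
    · intro b _ hb
      have : ¬ ((i : ℕ) = b) := fun h => hb (Fin.ext h.symm)
      simp [e, Jmat, this]
    · simp
  · refine Finset.sum_congr rfl fun j _ => ?_
    simp [e, Jmat]
    rfl

variable [IsDomain R]

theorem linearCombination_Vvec_apply {r n : ℕ} (d : R)
    (K : Matrix (Fin r) (Fin (n - r)) R) (c : Fin (n - r) → R) (i : Fin n) :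
    Fintype.linearCombination R (Vvec R r n d K) c i =
      if hi : (i : ℕ) < r then
        -(algebraMap R (FractionRing R) (K.mulVec c ⟨i, hi⟩)) / algebraMap R (FractionRing R) d
      else algebraMap R (FractionRing R) (c ⟨i - r, by omega⟩) := by
  rw [Fintype.linearCombination_apply, Finset.sum_apply]
  split_ifs with hi
  · simp only [Pi.smul_apply, Vvec, hi, dif_pos, Matrix.mulVec, dotProduct, map_sum, map_mul,
      Algebra.smul_def]
    rw [← Finset.sum_neg_distrib, Finset.sum_div]
    exact Finset.sum_congr rfl fun j _ => by ring
  · rw [Finset.sum_eq_single ⟨i - r, by omega⟩]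
    · have : (i : ℕ) = r + (i - r) := by omega
      simp [Vvec, hi, ← this, Algebra.smul_def]
    · intro j _ hj
      have : ¬ ((i : ℕ) = r + j) := fun h => hj (Fin.ext (by simp; omega))
      simp [Vvec, hi, this]
    · simp

theorem linearCombination_Vvec_injective {r n : ℕ} (d : R)
    (K : Matrix (Fin r) (Fin (n - r)) R) :
    Function.Injective (Fintype.linearCombination R (Vvec R r n d K)) := by
  intro a b h
  ext j
  have hj := congrFun h ⟨r + j, by omega⟩
  simpa [linearCombination_Vvec_apply] using hj

theorem range_linearCombination_Vvec {r n : ℕ} (d : R)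
    (K : Matrix (Fin r) (Fin (n - r)) R) :
    LinearMap.range (Fintype.linearCombination R (Vvec R r n d K)) = Wsub R r n d K :=
  Fintype.range_linearCombination R (Vvec R r n d K)

theorem mem_Nsub_iff {r n : ℕ} (hrn : r < n) {d : R} (hd : d ≠ 0)
    (K : Matrix (Fin r) (Fin (n - r)) R) (v : Fin n → FractionRing R) :
    v ∈ Nsub R r n d K ↔ ∃ c : Fin (n - r) → R, (∀ i, d ∣ K.mulVec c i) ∧
      Fintype.linearCombination R (Vvec R r n d K) c = v := by
  have hd' : algebraMap R (FractionRing R) d ≠ 0 := by simpa using hd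
  constructor
  · rintro ⟨x, hx, rfl⟩
    have hx' (i : Fin r) := (Jmat_mulVec_apply hrn d K x i).symm.trans (congrFun hx i)
    refine ⟨fun j => x ⟨r + j, by omega⟩, fun i => ⟨-x ⟨i, i.isLt.trans hrn⟩, ?_⟩, ?_⟩
    · have := hx' i
      simp only [Pi.zero_apply] at this
      linear_combination this
    · ext i
      rw [linearCombination_Vvec_apply]
      split_ifs with hi
      · have := hx' ⟨i, hi⟩
        simp only [Pi.zero_apply] at this
        rw [eq_neg_of_add_eq_zero_right this]
        simp [toFrac, hd']
      · have : r + (i - r : ℕ) = i := by omega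
        simp [toFrac, this]
  · rintro ⟨c, hc, rfl⟩
    choose y hy using hc
    refine ⟨fun i => if hi : (i : ℕ) < r then -y ⟨i, hi⟩ else c ⟨i - r, by omega⟩, ?_, ?_⟩
    · refine funext fun i => ?_
      rw [Matrix.mulVecLin_apply, Jmat_mulVec_apply hrn]
      simp [hy]
    · ext i
      rw [linearCombination_Vvec_apply]
      by_cases hi : (i : ℕ) < r
      · simp [toFrac, hi, hy, neg_div, hd']
      · simp [toFrac, hi]

/-- The dimension formulas over any field `k` which is the quotient of `R` by `Rp`. -/
theorem nonempty_quotient_equivs_of_residue_field {k : Type*} [Field k] [Algebra R k]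
    (hsurj : Function.Surjective (algebraMap R k)) {r n : ℕ} (hrn : r < n) {p : R} (hp0 : p ≠ 0)
    (hker : ∀ x, algebraMap R k x = 0 ↔ p ∣ x) (K : Matrix (Fin r) (Fin (n - r)) R) :
    Nonempty
      ((↥(Wsub R r n p K) ⧸ (Nsub R r n p K).comap (Wsub R r n p K).subtype) ≃ₗ[R]
        (Fin ((K.map (algebraMap R k)).rank) → k)) ∧
    Nonempty
      ((↥(Nsub R r n p K) ⧸ ((p • Wsub R r n p K).comap (Nsub R r n p K).subtype)) ≃ₗ[R]
        (Fin (n - r - (K.map (algebraMap R k)).rank) → k)) := by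
  set Kb : Matrix (Fin r) (Fin (n - r)) k := K.map (algebraMap R k)
  let φ := Fintype.linearCombination R (Vvec R r n p K)
  let e : (Fin (n - r) → R) ≃ₗ[R] Wsub R r n p K :=
    (LinearEquiv.ofInjective φ (linearCombination_Vvec_injective p K)).trans
      (LinearEquiv.ofEq _ _ (range_linearCombination_Vvec p K))
  have he (c) : (e c : Fin n → FractionRing R) = φ c := rfl
  let red : (Fin (n - r) → R) →ₗ[R] (Fin (n - r) → k) :=
    (Algebra.linearMap R k).compLeft (Fin (n - r))
  have red_surj : Function.Surjective red := hsurj.comp_left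
  have red_eq_zero (c) : red c = 0 ↔ ∃ b, c = p • b := by
    constructor
    · intro h
      choose b hb using fun j => (hker (c j)).1 (congrFun h j)
      exact ⟨b, funext hb⟩
    · rintro ⟨b, rfl⟩
      exact funext fun j => (hker _).2 ⟨b j, rfl⟩
  have mulVec_red (c i) : Kb.mulVec (red c) i = algebraMap R k (K.mulVec c i) :=
    (RingHom.map_mulVec (algebraMap R k) K c i).symm
  have mulVec_red_eq_zero (c) : Kb.mulVec (red c) = 0 ↔ ∀ i, p ∣ K.mulVec c i := by
    simp only [funext_iff, mulVec_red, Pi.zero_apply, hker]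
  have mem_N (c) : φ c ∈ Nsub R r n p K ↔ Kb.mulVec (red c) = 0 := by
    rw [mem_Nsub_iff hrn hp0, mulVec_red_eq_zero]
    constructor
    · rintro ⟨b, hb, h⟩
      rwa [← linearCombination_Vvec_injective p K h]
    · exact fun h => ⟨c, h, rfl⟩
  have N_le_W : Nsub R r n p K ≤ Wsub R r n p K := by
    intro v hv
    obtain ⟨c, -, rfl⟩ := (mem_Nsub_iff hrn hp0 K v).1 hv
    exact (e c).2
  have finrank_range : Module.finrank k (LinearMap.range Kb.mulVecLin) = Kb.rank := rfl
  have finrank_ker : Module.finrank k (LinearMap.ker Kb.mulVecLin) = n - r - Kb.rank := by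
    have := LinearMap.finrank_range_add_finrank_ker Kb.mulVecLin
    rw [finrank_range, Module.finrank_fin_fun] at this
    omega
  constructor
  · refine nonempty_quotient_equiv_of_range
      ((Kb.mulVecLin.restrictScalars R).comp (red.comp e.symm.toLinearMap)) _ ?_
      (LinearMap.range Kb.mulVecLin) ?_ finrank_range
    · ext w
      obtain ⟨c, rfl⟩ := e.surjective w
      simp [he, mem_N]
    · ext y
      constructor
      · rintro ⟨w, rfl⟩
        exact ⟨_, rfl⟩
      · rintro ⟨z, rfl⟩
        obtain ⟨c, rfl⟩ := red_surj z
        exact ⟨e c, by simp⟩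
  · refine nonempty_quotient_equiv_of_range
      (red.comp (e.symm.toLinearMap.comp (Submodule.inclusion N_le_W))) _ ?_
      (LinearMap.ker Kb.mulVecLin) ?_ finrank_ker
    · ext ⟨v, hv⟩
      obtain ⟨c, hc⟩ := e.surjective ⟨v, N_le_W hv⟩
      obtain rfl : φ c = v := congrArg Subtype.val hc
      have hinc : Submodule.inclusion N_le_W ⟨φ c, hv⟩ = e c := rfl
      simp only [LinearMap.mem_ker, LinearMap.comp_apply, hinc, LinearEquiv.coe_coe,
        LinearEquiv.symm_apply_apply, red_eq_zero, Submodule.mem_comap, Submodule.subtype_apply,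
        Submodule.mem_smul_pointwise_iff_exists]
      constructor
      · rintro ⟨b, rfl⟩
        exact ⟨φ b, (e b).2, (map_smul φ p b).symm⟩
      · rintro ⟨w, hw, h⟩
        obtain ⟨b, hb⟩ := e.surjective ⟨w, hw⟩
        obtain rfl : φ b = w := congrArg Subtype.val hb
        exact ⟨b, linearCombination_Vvec_injective p K (h.symm.trans (map_smul φ p b).symm)⟩
    · ext y
      constructor
      · rintro ⟨⟨v, hv⟩, rfl⟩
        obtain ⟨c, hc⟩ := e.surjective ⟨v, N_le_W hv⟩
        obtain rfl : φ c = v := congrArg Subtype.val hc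
        have hinc : Submodule.inclusion N_le_W ⟨φ c, hv⟩ = e c := rfl
        simpa [hinc] using (mem_N c).1 hv
      · intro hy
        obtain ⟨c, rfl⟩ := red_surj y
        refine ⟨⟨φ c, (mem_N c).2 hy⟩, ?_⟩
        have hinc : Submodule.inclusion N_le_W ⟨φ c, (mem_N c).2 hy⟩ = e c := rfl
        simp [hinc]

end FreeParametrization

/-- Suppose `d = p` is prime, and let `K̄` be the reduction of `K`
modulo `Rp` over the field `R̄ = R/Rp`. Then, as `R̄`-vector spaces,
`dim(W/N) = rank(K̄)` and `dim(N/pW) = f − rank(K̄)`. -/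
theorem dims_when_d_is_prime
    (R : Type*) [CommRing R] [IsDomain R] [IsPrincipalIdealRing R]
    (r n : ℕ) (hr : 0 < r) (hrn : r < n) (p : R) (hp : Prime p)
    (K : Matrix (Fin r) (Fin (n - r)) R) :
    Nonempty
      ((↥(Wsub R r n p K) ⧸ (Nsub R r n p K).comap (Wsub R r n p K).subtype) ≃ₗ[R]
        (Fin ((K.map (Ideal.Quotient.mk (Ideal.span {p}))).rank) →
          R ⧸ Ideal.span {p})) ∧
    Nonempty
      ((↥(Nsub R r n p K) ⧸
          ((p • Wsub R r n p K).comap (Nsub R r n p K).subtype)) ≃ₗ[R]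
        (Fin (n - r - (K.map (Ideal.Quotient.mk (Ideal.span {p}))).rank) →
          R ⧸ Ideal.span {p})) := by
  have hmax : (Ideal.span {p}).IsMaximal :=
    PrincipalIdealRing.isMaximal_of_irreducible hp.irreducible
  let : Field (R ⧸ Ideal.span {p}) := Ideal.Quotient.field _
  exact nonempty_quotient_equivs_of_residue_field (k := R ⧸ Ideal.span {p})
    Ideal.Quotient.mk_surjective hrn hp.ne_zero
    (fun x => Ideal.Quotient.eq_zero_iff_mem.trans Ideal.mem_span_singleton) K
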